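/- arXiv:2503.23582 — 2 statements merged into one kernel-verified Lean document; each statement's English description precedes it below -/
import Mathlib

section
/- Let f : ℕ → ℕ be an unbounded nondecreasing function. Then there exists a lawless group Γ generated by a finite set S such that f ⪯ 𝒜_Γ^S, i.e. there exists K ∈ ℕ with f(n) ≤ K · 𝒜_Γ^S(Kn) for all n ∈ ℕ. -/
/-- The length of the reduced word representing an element of the free group. -/
def wordLen {k : ℕ} (w : FreeGroup (Fin k)) : ℕ := w.toWord.length

/-- `w ∈ F_k` is a law for `Γ` if it vanishes under every evaluation in `Γ`. -/
def IsLaw (Γ : Type*) [Group Γ] {k : ℕ} (w : FreeGroup (Fin k)) : Prop :=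
  ∀ g : Fin k → Γ, FreeGroup.lift g w = 1

/-- A group is lawless if for every `k` no nontrivial element of `F_k` is a law for it. -/
def IsLawless (Γ : Type*) [Group Γ] : Prop :=
  ∀ (k : ℕ) (w : FreeGroup (Fin k)), w ≠ 1 → ¬ IsLaw Γ w

/-- Word length of `g` with respect to a generating set `S`: the least `n` such that `g`
is a product of `n` elements of `S ∪ S⁻¹`. -/
noncomputable def wlen {Γ : Type*} [Group Γ] (S : Set Γ) (g : Γ) : ℕ :=
  sInf {n | ∃ f : Fin n → Γ, (∀ i, f i ∈ S ∨ (f i)⁻¹ ∈ S) ∧ (List.ofFn f).prod = g}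

/-- The complexity `χ_Γ^S(w)`: the least total word length of a tuple on which `w`
does not vanish. -/
noncomputable def chi {Γ : Type*} [Group Γ] (S : Set Γ) {k : ℕ} (w : FreeGroup (Fin k)) : ℕ :=
  sInf {c | ∃ g : Fin k → Γ, FreeGroup.lift g w ≠ 1 ∧ c = ∑ i, wlen S (g i)}

/-- The lawlessness growth function `𝒜_Γ^S`. -/
noncomputable def lawGrowth {Γ : Type*} [Group Γ] (S : Set Γ) (l : ℕ) : ℕ :=
  sSup {c | ∃ w : FreeGroup (Fin 2), w ≠ 1 ∧ wordLen w ≤ l ∧ c = chi S w}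

/-- `F₁ ⪯ F₂` : there is `K ∈ ℕ` with `F₁(l) ≤ K·F₂(K·l)` for all `l`. -/
def Preceq (F₁ F₂ : ℕ → ℕ) : Prop :=
  ∃ K : ℕ, 1 ≤ K ∧ ∀ l : ℕ, 1 ≤ l → F₁ l ≤ K * F₂ (K * l)

/-- Equivalence of growth functions. -/
def EquivGrowth (F₁ F₂ : ℕ → ℕ) : Prop := Preceq F₁ F₂ ∧ Preceq F₂ F₁

open Equiv in
/-- A nontrivial reduced word of length `n` acts nontrivially on `n + 1` points. -/
theorem exists_perm_fin_lift_ne_one {k : ℕ} {w : FreeGroup (Fin k)} (hw : w ≠ 1) :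
    ∃ (n : ℕ) (h : Fin k → Perm (Fin (n + 1))), FreeGroup.lift h w ≠ 1 := by
  set L := w.toWord with hL
  have hred : ∀ (j : ℕ) (hj : j + 1 < L.length),
      L[j].1 = L[j + 1].1 → L[j].2 = L[j + 1].2 := by
    have := FreeGroup.isReduced_toWord (x := w)
    rw [FreeGroup.IsReduced, List.isChain_iff_getElem] at this
    exact fun j hj => this j hj
  have hpos : 0 < L.length := by
    rw [List.length_pos_iff, hL]
    simpa [FreeGroup.toWord_eq_nil_iff] using hw
  have key : ∀ i : Fin k, ∃ σ : Perm (Fin (L.length + 1)), ∀ (j : ℕ) (hj : j < L.length),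
      L[j].1 = i → (cond L[j].2 σ σ⁻¹) ⟨j + 1, by omega⟩ = ⟨j, by omega⟩ := by
    intro i
    have hinj : ∀ c : Bool, Function.Injective
        (fun j : {j : Fin L.length // L[j.1].1 = i} =>
          if L[j.1.1].2 = c then (⟨j.1 + 1, by omega⟩ : Fin (L.length + 1))
          else ⟨j.1, by omega⟩) := by
      rintro c ⟨⟨j, hj⟩, hji⟩ ⟨⟨j', hj'⟩, hji'⟩ h
      simp only at hji hji'
      simp only [Subtype.mk.injEq, Fin.mk.injEq]
      dsimp only at h
      split_ifs at h with h1 h2 h2 <;> simp only [Fin.mk.injEq] at h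
      · omega
      · subst h
        have := hred j hj' (hji.trans hji'.symm)
        exact absurd (this ▸ h1) h2
      · subst h
        have := hred j' hj (hji'.trans hji.symm)
        exact absurd (this ▸ h2) h1
      · exact h
    obtain ⟨σ, hσ⟩ := Perm.exists_extending_pair _ _ (hinj true) (hinj false)
    refine ⟨σ, fun j hj hji => ?_⟩
    have := hσ ⟨⟨j, hj⟩, hji⟩
    dsimp only at this
    cases hb : L[j].2
    · simp only [hb] at this
      simp at this
      exact Perm.inv_eq_iff_eq.2 this.symm
    · simp only [hb] at this
      simpa using this
  choose h hh using key
  refine ⟨L.length, h, fun hone => ?_⟩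
  have hact : ∀ m (hm : m ≤ L.length),
      (((L.drop (L.length - m)).map fun x => cond x.2 (h x.1) (h x.1)⁻¹).prod)
        ⟨L.length, by omega⟩ = ⟨L.length - m, by omega⟩ := by
    intro m
    induction m with
    | zero => intro _; simp
    | succ m ih =>
      intro hm
      have h1 : L.length - m = L.length - (m + 1) + 1 := by omega
      rw [List.drop_eq_getElem_cons (by omega), List.map_cons, List.prod_cons, Perm.mul_apply]
      have h2 := ih (by omega)
      simp only [h1] at h2
      rw [h2]
      exact hh _ _ _ rfl
  have h0 := hact L.length le_rfl
  simp only [Nat.sub_self, List.drop_zero] at h0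
  rw [← FreeGroup.lift_mk, show FreeGroup.mk L = w from FreeGroup.mk_toWord, hone] at h0
  simp only [Perm.one_apply, Fin.mk.injEq] at h0
  omega

/-- The transposition `(i, i + 1)` of `ℕ`. -/
def adjSwap (i : ℕ) : Equiv.Perm ℕ := Equiv.swap i (i + 1)

theorem adjSwap_sq (i : ℕ) : adjSwap i ^ 2 = 1 := by
  rw [sq, adjSwap, Equiv.swap_mul_self]

theorem adjSwap_mem_range_ofSubtype {i m : ℕ} (h : i + 1 < m) :
    adjSwap i ∈ (Equiv.Perm.ofSubtype (p := fun x : ℕ => x < m)).range :=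
  ⟨Equiv.swap ⟨i, by omega⟩ ⟨i + 1, h⟩, by rw [Equiv.Perm.ofSubtype_swap_eq]; rfl⟩

theorem pow_factorial_eq_one_of_mem_range_ofSubtype {m : ℕ} {σ : Equiv.Perm ℕ}
    (h : σ ∈ (Equiv.Perm.ofSubtype (p := fun x : ℕ => x < m)).range) : σ ^ m.factorial = 1 := by
  obtain ⟨τ, rfl⟩ := h
  have hcard : Nat.card (Equiv.Perm {x : ℕ // x < m}) = m.factorial := by
    rw [Nat.card_perm, Nat.card_congr Fin.equivSubtype.symm, Nat.card_fin]
  rw [← map_pow, ← hcard, pow_card_eq_one', map_one]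

theorem extendDomainHom_mem_closure_adjSwap {n : ℕ} (σ : Equiv.Perm (Fin (n + 1))) :
    Equiv.Perm.extendDomainHom Fin.equivSubtype σ ∈ Subgroup.closure (Set.range adjSwap) := by
  have hσ : σ ∈ Submonoid.closure
      (Set.range fun i : Fin n => Equiv.swap i.castSucc i.succ) := by
    rw [Equiv.Perm.mclosure_swap_castSucc_succ]; trivial
  induction hσ using Submonoid.closure_induction with
  | one => rw [map_one]; exact one_mem _
  | mul x y _ _ hx hy => rw [map_mul]; exact mul_mem hx hy
  | mem x hx =>
    obtain ⟨i, rfl⟩ := hx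
    refine Subgroup.subset_closure ⟨i, ?_⟩
    ext x
    by_cases hx : x < n + 1
    · obtain ⟨y, rfl⟩ : ∃ y : Fin (n + 1), x = Fin.equivSubtype y := ⟨⟨x, hx⟩, rfl⟩
      change _ = Equiv.Perm.extendDomain _ Fin.equivSubtype _
      rw [Equiv.Perm.extendDomain_apply_image]
      simp only [adjSwap, Equiv.swap_apply_def, Fin.equivSubtype_apply, Fin.ext_iff]
      simp only [Fin.val_castSucc, Fin.val_succ]
      split_ifs <;> rfl
    · change _ = Equiv.Perm.extendDomain _ Fin.equivSubtype _
      rw [Equiv.Perm.extendDomain_apply_not_subtype (b := x) _ _ hx, adjSwap,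
        Equiv.swap_apply_of_ne_of_ne] <;> omega

theorem exists_mem_closure_adjSwap_lift_ne_one {k : ℕ} {w : FreeGroup (Fin k)} (hw : w ≠ 1) :
    ∃ h : Fin k → Equiv.Perm ℕ,
      (∀ i, h i ∈ Subgroup.closure (Set.range adjSwap)) ∧ FreeGroup.lift h w ≠ 1 := by
  obtain ⟨n, h, hne⟩ := exists_perm_fin_lift_ne_one hw
  refine ⟨fun i => Equiv.Perm.extendDomainHom Fin.equivSubtype (h i),
    fun i => extendDomainHom_mem_closure_adjSwap _, fun h1 => hne ?_⟩
  apply Equiv.Perm.extendDomainHom_injective Fin.equivSubtype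
  rw [map_one, ← h1]
  exact DFunLike.congr_fun (FreeGroup.ext_hom (f := (Equiv.Perm.extendDomainHom
    Fin.equivSubtype).comp (FreeGroup.lift h)) (g := FreeGroup.lift _) (by simp)) w

/-- The permutation of `ℤ × ℕ` translating the first coordinate by `1`. -/
def fibreShift : Equiv.Perm (Σ _ : ℤ, ℕ) where
  toFun x := ⟨x.1 + 1, x.2⟩
  invFun x := ⟨x.1 - 1, x.2⟩
  left_inv x := by simp
  right_inv x := by simp

/-- A family of permutations of `ℕ` acting fibrewise on `ℤ × ℕ`. -/
abbrev fibreHom : (ℤ → Equiv.Perm ℕ) →* Equiv.Perm (Σ _ : ℤ, ℕ) :=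
  Equiv.Perm.sigmaCongrRightHom _

theorem fibreShift_apply (z : ℤ) (x : ℕ) : fibreShift ⟨z, x⟩ = ⟨z + 1, x⟩ := rfl

theorem fibreHom_apply (b : ℤ → Equiv.Perm ℕ) (z : ℤ) (x : ℕ) :
    fibreHom b ⟨z, x⟩ = ⟨z, b z x⟩ := rfl

/-- The generators of a lamplighter-like group of permutations of `ℤ × ℕ`. -/
def lampGens (a : ℤ → Equiv.Perm ℕ) : Set (Equiv.Perm (Σ _ : ℤ, ℕ)) :=
  {fibreShift, fibreHom a}

theorem conj_fibreShift_mem (a b : ℤ → Equiv.Perm ℕ) (n : ℕ)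
    (hb : fibreHom b ∈ Subgroup.closure (lampGens a)) :
    fibreHom (fun z => b (z + n)) ∈ Subgroup.closure (lampGens a) := by
  have hs : fibreShift ∈ Subgroup.closure (lampGens a) :=
    Subgroup.subset_closure (Or.inl rfl)
  induction n with
  | zero => simpa using hb
  | succ n ih =>
    have : fibreHom (fun z => b (z + (n + 1 : ℕ))) =
        fibreShift⁻¹ * fibreHom (fun z => b (z + n)) * fibreShift := by
      ext1 ⟨z, x⟩
      rw [mul_assoc, Equiv.Perm.mul_apply, Equiv.Perm.eq_inv_iff_eq]
      rw [Equiv.Perm.mul_apply, fibreHom_apply, fibreShift_apply, fibreShift_apply,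
        fibreHom_apply, Nat.cast_succ, add_assoc z, add_comm (1 : ℤ)]
    rw [this]
    exact mul_mem (mul_mem (inv_mem hs) ih) hs

/-- The function `ℤ → Perm ℕ` with value `(i, i + 1)` at `p i`, trivial elsewhere. -/
noncomputable def sparse (p : ℕ → ℕ) : ℤ → Equiv.Perm ℕ :=
  Function.extend (fun i => (p i : ℤ)) adjSwap 1

theorem sparse_apply {p : ℕ → ℕ} (hp : Function.Injective p) (i : ℕ) :
    sparse p (p i) = adjSwap i :=
  (Nat.cast_injective.comp hp).extend_apply adjSwap 1 i

theorem sparse_eq_one_or (p : ℕ → ℕ) (hp : Function.Injective p) (z : ℤ) :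
    sparse p z = 1 ∨ ∃ i, z = p i ∧ sparse p z = adjSwap i := by
  by_cases h : ∃ i, (p i : ℤ) = z
  · obtain ⟨i, rfl⟩ := h
    exact Or.inr ⟨i, rfl, sparse_apply hp i⟩
  · exact Or.inl (Function.extend_apply' _ _ _ h)

/-- The group generated by `lampGens a`. -/
abbrev Lamp (a : ℤ → Equiv.Perm ℕ) : Type := Subgroup.closure (lampGens a)

/-- The generating set of `Lamp a`. -/
abbrev lampSet (a : ℤ → Equiv.Perm ℕ) : Set (Lamp a) := Subtype.val ⁻¹' lampGens a

theorem exists_fibreHom_mem_of_mem_closure {p : ℕ → ℕ} (hp : Function.Injective p)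
    {σ : Equiv.Perm ℕ} (hσ : σ ∈ Subgroup.closure (Set.range adjSwap)) :
    ∃ b : ℤ → Equiv.Perm ℕ, fibreHom b ∈ Subgroup.closure (lampGens (sparse p)) ∧ b 0 = σ := by
  have hle : Subgroup.closure (Set.range adjSwap) ≤
      ((Subgroup.closure (lampGens (sparse p))).comap fibreHom).map
        (Pi.evalMonoidHom (fun _ : ℤ => Equiv.Perm ℕ) 0) := by
    rw [Subgroup.closure_le]
    rintro _ ⟨i, rfl⟩
    refine ⟨fun z => sparse p (z + p i), ?_, ?_⟩
    · exact conj_fibreShift_mem _ _ _ (Subgroup.subset_closure (Or.inr rfl))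
    · simp [sparse_apply hp]
  exact hle hσ

theorem isLawless_lamp {p : ℕ → ℕ} (hp : Function.Injective p) :
    IsLawless (Lamp (sparse p)) := by
  intro k w hw hlaw
  obtain ⟨h, hmem, hne⟩ := exists_mem_closure_adjSwap_lift_ne_one hw
  choose b hb hb0 using fun i => exists_fibreHom_mem_of_mem_closure hp (hmem i)
  apply hne
  have h1 := congrArg Subtype.val (hlaw fun i => ⟨fibreHom (b i), hb i⟩)
  have h2 : ((FreeGroup.lift fun i => (⟨fibreHom (b i), hb i⟩ : Lamp (sparse p))) w).val =
      fibreHom (FreeGroup.lift b w) :=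
    DFunLike.congr_fun (FreeGroup.ext_hom (f := (Subgroup.subtype _).comp (FreeGroup.lift _))
      (g := fibreHom.comp (FreeGroup.lift b)) (by simp)) w
  have h3 : FreeGroup.lift b w = 1 := by
    apply Equiv.Perm.sigmaCongrRightHom_injective (β := fun _ : ℤ => ℕ)
    rw [map_one]
    exact h2.symm.trans h1
  have h4 : FreeGroup.lift h w = (FreeGroup.lift b w) 0 :=
    DFunLike.congr_fun (FreeGroup.ext_hom (f := FreeGroup.lift h)
      (g := (Pi.evalMonoidHom (fun _ : ℤ => Equiv.Perm ℕ) 0).comp (FreeGroup.lift b))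
      (by simp [hb0])) w
  rw [h4, h3, Pi.one_apply]

/-- `g` translates the first coordinate by `m`, where `|m| ≤ R`, and acts on the fibre over `z` by
a product of values of `a` on the interval `[z - R, z + R]`, and of their inverses. -/
def IsLocal (a : ℤ → Equiv.Perm ℕ) (R m : ℤ) (g : Equiv.Perm (Σ _ : ℤ, ℕ)) : Prop :=
  |m| ≤ R ∧ ∃ φ : ℤ → Equiv.Perm ℕ,
    (∀ z, φ z ∈ Subgroup.closure (a '' Set.Icc (z - R) (z + R))) ∧
    ∀ z x, g ⟨z, x⟩ = ⟨z + m, φ z x⟩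

namespace IsLocal

variable {a : ℤ → Equiv.Perm ℕ} {R R' m m' : ℤ} {g h : Equiv.Perm (Σ _ : ℤ, ℕ)}

theorem one (a : ℤ → Equiv.Perm ℕ) : IsLocal a 0 0 1 :=
  ⟨by simp, 1, fun _ => one_mem _, fun z x => by simp⟩

theorem fibreShift (a : ℤ → Equiv.Perm ℕ) : IsLocal a 1 1 fibreShift :=
  ⟨by simp, 1, fun _ => one_mem _, fun z x => rfl⟩

theorem fibreHom (a : ℤ → Equiv.Perm ℕ) : IsLocal a 0 0 (fibreHom a) :=
  ⟨by simp, a, fun z => Subgroup.subset_closure ⟨z, by simp, rfl⟩, fun z x => by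
    rw [fibreHom_apply, add_zero]⟩

theorem mono (hg : IsLocal a R m g) (hR : R ≤ R') : IsLocal a R' m g := by
  obtain ⟨hm, φ, hφ, hgφ⟩ := hg
  exact ⟨hm.trans hR, φ, fun z => Subgroup.closure_mono (Set.image_mono
    (Set.Icc_subset_Icc (by omega) (by omega))) (hφ z), hgφ⟩

theorem mul (hg : IsLocal a R m g) (hh : IsLocal a R' m' h) :
    IsLocal a (R + R') (m' + m) (g * h) := by
  obtain ⟨hm, φ, hφ, hgφ⟩ := hg
  obtain ⟨hm', ψ, hψ, hhψ⟩ := hh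
  rw [abs_le] at hm hm'
  refine ⟨abs_le.2 ⟨by omega, by omega⟩, fun z => φ (z + m') * ψ z, fun z => mul_mem ?_ ?_,
    fun z x => ?_⟩
  · exact Subgroup.closure_mono (Set.image_mono
      (Set.Icc_subset_Icc (by omega) (by omega))) (hφ _)
  · exact Subgroup.closure_mono (Set.image_mono
      (Set.Icc_subset_Icc (by omega) (by omega))) (hψ _)
  · rw [Equiv.Perm.mul_apply, hhψ, hgφ, add_assoc, Equiv.Perm.mul_apply]

theorem inv (hg : IsLocal a R m g) : IsLocal a (2 * R) (-m) g⁻¹ := by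
  obtain ⟨hm, φ, hφ, hgφ⟩ := hg
  rw [abs_le] at hm
  refine ⟨abs_le.2 ⟨by omega, by omega⟩, fun z => (φ (z + -m))⁻¹, fun z => inv_mem ?_,
    fun z x => ?_⟩
  · exact Subgroup.closure_mono (Set.image_mono
      (Set.Icc_subset_Icc (by omega) (by omega))) (hφ _)
  · rw [Equiv.Perm.inv_eq_iff_eq, hgφ, neg_add_cancel_right, ← Equiv.Perm.mul_apply, mul_inv_cancel,
      Equiv.Perm.one_apply]

theorem commutator (hg : IsLocal a R m g) (hh : IsLocal a R m' h) :
    IsLocal a (6 * R) 0 (g * h * g⁻¹ * h⁻¹) := by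
  have := ((hg.mul hh).mul hg.inv).mul hh.inv
  rwa [show R + R + 2 * R + 2 * R = 6 * R by ring,
    show -m' + (-m + (m' + m)) = 0 by ring] at this

theorem pow_eq_one (hg : IsLocal a R 0 g) {N : ℕ}
    (hN : ∀ z, ∀ σ ∈ Subgroup.closure (a '' Set.Icc (z - R) (z + R)), σ ^ N = 1) :
    g ^ N = 1 := by
  obtain ⟨-, φ, hφ, hgφ⟩ := hg
  have : g = _root_.fibreHom φ := by
    ext1 ⟨z, x⟩
    rw [hgφ, fibreHom_apply, add_zero]
  have hφN : φ ^ N = 1 := funext fun z => hN z _ (hφ z)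
  rw [this, ← map_pow, hφN, map_one]

end IsLocal

theorem exists_isLocal_of_mem_lampSet {a : ℤ → Equiv.Perm ℕ} {g : Lamp a}
    (hg : g ∈ lampSet a ∨ g⁻¹ ∈ lampSet a) : ∃ m, IsLocal a 2 m g.val := by
  have key : ∀ s : Lamp a, s ∈ lampSet a → ∃ m, IsLocal a 1 m s.val := by
    rintro s (hs | hs)
    · exact ⟨1, hs ▸ IsLocal.fibreShift a⟩
    · exact ⟨0, hs ▸ (IsLocal.fibreHom a).mono zero_le_one⟩
  rcases hg with hg | hg
  · obtain ⟨m, hm⟩ := key _ hg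
    exact ⟨m, hm.mono one_le_two⟩
  · obtain ⟨m, hm⟩ := key _ hg
    exact ⟨-m, by simpa using hm.inv⟩

theorem exists_isLocal_prod {a : ℤ → Equiv.Perm ℕ} (l : List (Lamp a))
    (hl : ∀ g ∈ l, g ∈ lampSet a ∨ g⁻¹ ∈ lampSet a) :
    ∃ m, IsLocal a (2 * l.length) m l.prod.val := by
  induction l with
  | nil => exact ⟨0, by simpa using IsLocal.one a⟩
  | cons g l ih =>
    obtain ⟨m, hm⟩ := exists_isLocal_of_mem_lampSet (hl g (by simp))
    obtain ⟨m', hm'⟩ := ih fun x hx => hl x (by simp [hx])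
    refine ⟨m' + m, ?_⟩
    have := hm.mul hm'
    rwa [List.prod_cons, List.length_cons, Subgroup.coe_mul, Nat.cast_succ, mul_add, mul_one,
      add_comm (2 * (l.length : ℤ))]

theorem wlen_set_nonempty {Γ : Type*} [Group Γ] {S : Set Γ} (hS : Subgroup.closure S = ⊤)
    (g : Γ) :
    {n | ∃ f : Fin n → Γ, (∀ i, f i ∈ S ∨ (f i)⁻¹ ∈ S) ∧ (List.ofFn f).prod = g}.Nonempty := by
  have hg : g ∈ Submonoid.closure (S ∪ S⁻¹) := by
    rw [← Subgroup.closure_toSubmonoid, hS]; trivial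
  obtain ⟨l, hl, rfl⟩ := Submonoid.exists_list_of_mem_closure hg
  exact ⟨l.length, l.get, fun i => hl _ (List.get_mem l i), by rw [List.ofFn_get]⟩

theorem closure_lampSet (a : ℤ → Equiv.Perm ℕ) : Subgroup.closure (lampSet a) = ⊤ :=
  Subgroup.closure_closure_coe_preimage

theorem exists_isLocal_wlen {a : ℤ → Equiv.Perm ℕ} (g : Lamp a) :
    ∃ m, IsLocal a (2 * wlen (lampSet a) g) m g.val := by
  obtain ⟨f, hf, hfg⟩ := Nat.sInf_mem (wlen_set_nonempty (closure_lampSet a) g)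
  obtain ⟨m, hm⟩ := exists_isLocal_prod (List.ofFn f) fun x hx => by
    obtain ⟨i, rfl⟩ := (List.mem_ofFn' f x).1 hx
    exact hf i
  rw [hfg, List.length_ofFn] at hm
  exact ⟨m, hm⟩

/-- The word `[x, y] ^ N`. -/
def commPow (N : ℕ) : FreeGroup (Fin 2) :=
  (FreeGroup.of 0 * FreeGroup.of 1 * (FreeGroup.of 0)⁻¹ * (FreeGroup.of 1)⁻¹) ^ N

theorem commPow_ne_one {N : ℕ} (hN : N ≠ 0) : commPow N ≠ 1 := by
  rw [commPow, Ne, pow_eq_one_iff_left hN]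
  decide

theorem wordLen_commPow_le (N : ℕ) : wordLen (commPow N) ≤ 4 * N := by
  change FreeGroup.norm _ ≤ _
  have hc : FreeGroup.norm (FreeGroup.of (0 : Fin 2) * FreeGroup.of 1 * (FreeGroup.of 0)⁻¹ *
      (FreeGroup.of 1)⁻¹) = 4 := by decide
  induction N with
  | zero => simp [commPow]
  | succ N ih =>
    rw [commPow, pow_succ]
    refine (FreeGroup.norm_mul_le _ _).trans ?_
    rw [hc]
    exact Nat.add_le_add_right ih 4

theorem lift_commPow {Γ : Type*} [Group Γ] (g : Fin 2 → Γ) (N : ℕ) :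
    FreeGroup.lift g (commPow N) = (g 0 * g 1 * (g 0)⁻¹ * (g 1)⁻¹) ^ N := by
  simp [commPow]

/-- A short interval meets either only the first few values of `p`, or at most one value. -/
theorem pow_factorial_eq_one_of_mem_closure_sparse {p : ℕ → ℕ} (hp : StrictMono p) {k : ℕ}
    {D : ℤ} (hD : ∀ i, k ≤ i → (p i : ℤ) + D ≤ p (i + 1)) {u v : ℤ} (huv : v - u < D)
    {σ : Equiv.Perm ℕ} (hσ : σ ∈ Subgroup.closure (sparse p '' Set.Icc u v)) :
    σ ^ (k + 2).factorial = 1 := by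
  by_cases hbig : ∃ i, k < i ∧ (p i : ℤ) ∈ Set.Icc u v
  · obtain ⟨i, hki, hi⟩ := hbig
    have huniq : ∀ j, (p j : ℤ) ∈ Set.Icc u v → j = i := by
      intro j hj
      simp only [Set.mem_Icc] at hi hj
      rcases lt_trichotomy j i with h | h | h
      · obtain ⟨i, rfl⟩ : ∃ i', i = i' + 1 := ⟨i - 1, by omega⟩
        have h1 := hD i (by omega)
        have h2 := hp.monotone (show j ≤ i by omega)
        omega
      · exact h
      · have h1 := hD i hki.le
        have h2 := hp.monotone (show i + 1 ≤ j by omega)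
        omega
    have hle : Subgroup.closure (sparse p '' Set.Icc u v) ≤ Subgroup.zpowers (adjSwap i) := by
      rw [Subgroup.closure_le]
      rintro _ ⟨z, hz, rfl⟩
      rcases sparse_eq_one_or p hp.injective z with h | ⟨j, rfl, h⟩
      · rw [h]; exact one_mem _
      · rw [h, huniq j hz]; exact Subgroup.mem_zpowers _
    obtain ⟨n, rfl⟩ := hle hσ
    obtain ⟨c, hc⟩ : 2 ∣ (k + 2).factorial := Nat.dvd_factorial two_pos (by omega)
    rw [hc, pow_mul]
    simp only
    rw [← zpow_natCast _ 2, zpow_comm, zpow_natCast, adjSwap_sq, one_zpow, one_pow]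
  · push Not at hbig
    apply pow_factorial_eq_one_of_mem_range_ofSubtype
    refine (Subgroup.closure_le _).2 ?_ hσ
    rintro _ ⟨z, hz, rfl⟩
    rcases sparse_eq_one_or p hp.injective z with h | ⟨j, rfl, h⟩
    · rw [h]; exact one_mem _
    · rw [h]
      refine adjSwap_mem_range_ofSubtype ?_
      by_contra hj
      exact hbig j (by omega) hz

theorem lt_chi_commPow {p : ℕ → ℕ} (hp : StrictMono p) {k n : ℕ}
    (hD : ∀ i, k ≤ i → p i + (24 * n + 1) ≤ p (i + 1)) :
    n < chi (lampSet (sparse p)) (commPow (k + 2).factorial) := by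
  have hne : {c | ∃ g : Fin 2 → Lamp (sparse p),
      FreeGroup.lift g (commPow (k + 2).factorial) ≠ 1 ∧
        c = ∑ i, wlen (lampSet (sparse p)) (g i)}.Nonempty := by
    have := isLawless_lamp hp.injective 2 _ (commPow_ne_one (Nat.factorial_ne_zero (k + 2)))
    simp only [IsLaw, not_forall] at this
    obtain ⟨g, hg⟩ := this
    exact ⟨_, g, hg, rfl⟩
  obtain ⟨g, hg, hsum⟩ := Nat.sInf_mem hne
  rw [chi, hsum]
  by_contra! hle
  apply hg
  rw [Fin.sum_univ_two] at hle
  obtain ⟨m₀, h₀⟩ := exists_isLocal_wlen (g 0)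
  obtain ⟨m₁, h₁⟩ := exists_isLocal_wlen (g 1)
  have hc := (h₀.mono (R' := 2 * n) (by omega)).commutator (h₁.mono (R' := 2 * n) (by omega))
  rw [lift_commPow]
  apply Subtype.ext
  refine hc.pow_eq_one fun z σ hσ => ?_
  refine pow_factorial_eq_one_of_mem_closure_sparse hp (D := 24 * n + 1) ?_ (by omega) hσ
  intro i hi
  exact_mod_cast hD i hi

theorem chi_le_lawGrowth {Γ : Type*} [Group Γ] (S : Set Γ) {w : FreeGroup (Fin 2)} {l : ℕ}
    (hw : w ≠ 1) (hl : wordLen w ≤ l) : chi S w ≤ lawGrowth S l := by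
  refine le_csSup ?_ ⟨w, hw, hl, rfl⟩
  have hfin : {w : FreeGroup (Fin 2) | wordLen w ≤ l}.Finite :=
    (List.finite_length_le (Fin 2 × Bool) l).preimage FreeGroup.toWord_injective.injOn
  refine ((hfin.image (chi S)).subset ?_).bddAbove
  rintro _ ⟨w, -, hl, rfl⟩
  exact ⟨w, hl, rfl⟩

/-- For every unbounded nondecreasing `f : ℕ → ℕ` there is a lawless group
`Γ` generated by a finite set `S` with `f ⪯ 𝒜_Γ^S`. -/
theorem stmt0 (f : ℕ → ℕ)
    (hmono : ∀ ⦃m n : ℕ⦄, 1 ≤ m → m ≤ n → f m ≤ f n)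
    (hunb : ∀ N : ℕ, ∃ n : ℕ, 1 ≤ n ∧ N ≤ f n) :
    ∃ (Γ : Type) (_ : Group Γ) (S : Set Γ),
      S.Finite ∧ Subgroup.closure S = ⊤ ∧ IsLawless Γ ∧ Preceq f (lawGrowth S) := by
  let L : ℕ → ℕ := fun k => 4 * (k + 2).factorial
  let d : ℕ → ℕ := fun i => 24 * f (L (i + 1)) + 1
  have hL : StrictMono L := fun i j hij => Nat.mul_lt_mul_of_pos_left
    ((Nat.factorial_lt (by omega)).2 (by omega)) (by norm_num)
  have hLpos : ∀ k, 1 ≤ L k := fun k => Nat.mul_pos (by norm_num) (Nat.factorial_pos _)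
  let p : ℕ → ℕ := fun i => ∑ j ∈ Finset.range i, d j
  have hpsucc : ∀ i, p (i + 1) = p i + d i := fun i => Finset.sum_range_succ _ _
  have hp : StrictMono p := strictMono_nat_of_lt_succ fun i => by
    rw [hpsucc]; exact Nat.lt_add_of_pos_right (Nat.succ_pos _)
  refine ⟨Lamp (sparse p), inferInstance, lampSet (sparse p), ?_, closure_lampSet _,
    isLawless_lamp hp.injective, 8, by norm_num, fun l hl => ?_⟩
  · exact (Set.toFinite {fibreShift, fibreHom (sparse p)}).preimage Subtype.val_injective.injOn
  obtain ⟨k, hk, hk'⟩ : ∃ k, L k ≤ 8 * l ∧ 8 * l < L (k + 1) := by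
    have hex : ∃ k, 8 * l < L (k + 1) := ⟨8 * l, (Nat.lt_succ_self _).trans_le (hL.le_apply)⟩
    refine ⟨Nat.find hex, ?_, Nat.find_spec hex⟩
    rcases h : Nat.find hex with _ | k
    · change 8 ≤ 8 * l; omega
    · exact not_lt.1 (Nat.find_min hex (m := k) (by omega))
  have hchi : f (L (k + 1)) < chi (lampSet (sparse p)) (commPow (k + 2).factorial) := by
    refine lt_chi_commPow hp fun i hi => ?_
    rw [hpsucc]
    have := hmono (hLpos (k + 1)) (hL.monotone (show k + 1 ≤ i + 1 by omega))
    simp only [d]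
    omega
  have hgrow := chi_le_lawGrowth (lampSet (sparse p)) (l := 8 * l)
    (commPow_ne_one (Nat.factorial_ne_zero (k + 2))) ((wordLen_commPow_le _).trans hk)
  have hf := hmono hl (show l ≤ L (k + 1) by omega)
  omega
end

section
/- Let f : ℕ → ℕ be a surjective unbounded nondecreasing function, and suppose there exists M ∈ ℕ with M ≥ 2 such that f(Mn) ≤ M·f(n) for all n ∈ ℕ. Then there exists a lawless group Γ generated by a finite set S such that 𝒜_Γ^S ≈ f. -/
/-- The action of `ℤ` on the free group on `α × ℤ` by translation of the indices. -/
def indexShift (α : Type*) : Multiplicative ℤ →* MulAut (FreeGroup (α × ℤ)) where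
  toFun m := FreeGroup.freeGroupCongr ((Equiv.refl α).prodCongr (Equiv.addRight m.toAdd))
  map_one' := by
    ext x
    simp
  map_mul' m n := by
    apply MulEquiv.toMonoidHom_injective
    apply FreeGroup.ext_hom
    rintro ⟨a, k⟩
    simp [add_left_comm, add_comm]

theorem indexShift_of {α : Type*} (m : Multiplicative ℤ) (a : α) (k : ℤ) :
    indexShift α m (FreeGroup.of (a, k)) = FreeGroup.of (a, k + m.toAdd) := by
  simp [indexShift]

theorem FreeGroup.norm_map_le {α β : Type*} [DecidableEq α] [DecidableEq β] (f : α → β)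
    (w : FreeGroup α) : (FreeGroup.map f w).norm ≤ w.norm := by
  conv_lhs => rw [← FreeGroup.mk_toWord (x := w), FreeGroup.map.mk]
  exact FreeGroup.norm_mk_le.trans (by simp [FreeGroup.norm])

theorem norm_indexShift_le {α : Type*} [DecidableEq α] (m : Multiplicative ℤ)
    (w : FreeGroup (α × ℤ)) : (indexShift α m w).norm ≤ w.norm :=
  FreeGroup.norm_map_le _ w

theorem FreeGroup.mk_cons_eq {α : Type*} (a : α) (b : Bool) (L : List (α × Bool)) :
    FreeGroup.mk ((a, b) :: L) =
      (if b then FreeGroup.of a else (FreeGroup.of a)⁻¹) * FreeGroup.mk L := by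
  cases b <;> simp [FreeGroup.of, FreeGroup.inv_mk, FreeGroup.invRev]

/-- The homomorphism sending the letter `x` to the generator of `ℤ` and every other letter to
itself, exhibiting a free group as a subgroup of a semidirect product of a free group
with `ℤ`. -/
def unwind {α : Type*} [DecidableEq α] (x : α) :
    FreeGroup α →* FreeGroup (α × ℤ) ⋊[indexShift α] Multiplicative ℤ :=
  FreeGroup.lift fun y ↦
    if y = x then SemidirectProduct.inr (Multiplicative.ofAdd 1)
    else SemidirectProduct.inl (FreeGroup.of (y, 0))

/-- The left inverse of `unwind x`. -/
def rewind {α : Type*} (x : α) :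
    FreeGroup (α × ℤ) ⋊[indexShift α] Multiplicative ℤ →* FreeGroup α :=
  SemidirectProduct.lift
    (FreeGroup.lift fun p ↦ FreeGroup.of x ^ p.2 * FreeGroup.of p.1 * FreeGroup.of x ^ (-p.2))
    (zpowersHom _ (FreeGroup.of x)) fun m ↦ by
      apply FreeGroup.ext_hom
      rintro ⟨a, k⟩
      simp only [MonoidHom.comp_apply, MulEquiv.coe_toMonoidHom, indexShift_of,
        FreeGroup.lift_apply_of, zpowersHom_apply, MulAut.conj_apply]
      group

theorem unwind_injective {α : Type*} [DecidableEq α] (x : α) :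
    Function.Injective (unwind x) := by
  have h : (rewind x).comp (unwind x) = MonoidHom.id _ := by
    apply FreeGroup.ext_hom
    intro a
    by_cases ha : a = x <;> simp [rewind, unwind, ha]
  exact Function.LeftInverse.injective (g := rewind x) fun w ↦ DFunLike.congr_fun h w

theorem norm_left_unwind_mk_le {α : Type*} [DecidableEq α] (x : α) (L : List (α × Bool)) :
    (unwind x (FreeGroup.mk L)).left.norm ≤ (L.filter (·.1 ≠ x)).length := by
  induction L with
  | nil => simp [FreeGroup.one_eq_mk.symm]
  | cons p L ih =>
    obtain ⟨a, b⟩ := p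
    rw [FreeGroup.mk_cons_eq, map_mul, SemidirectProduct.mul_left]
    refine (FreeGroup.norm_mul_le _ _).trans ?_
    have h := norm_indexShift_le
      (unwind x (if b then FreeGroup.of a else (FreeGroup.of a)⁻¹)).right
      (unwind x (FreeGroup.mk L)).left
    by_cases ha : a = x
    · have h' : (unwind x (if b then FreeGroup.of a else (FreeGroup.of a)⁻¹)).left = 1 := by
        cases b <;> simp [unwind, ha]
      rw [h', FreeGroup.norm_one, zero_add, List.filter_cons_of_neg (by simp [ha])]
      exact h.trans ih
    · have h' : (unwind x (if b then FreeGroup.of a else (FreeGroup.of a)⁻¹)).left.norm = 1 := by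
        cases b <;> simp [unwind, ha]
      rw [h']
      simp only [ne_eq, decide_not] at ih
      simp [ha]
      omega

theorem norm_left_unwind_lt {α : Type*} [DecidableEq α] (x : α) (b : Bool)
    (L : List (α × Bool)) : (unwind x (FreeGroup.mk ((x, b) :: L))).left.norm < L.length + 1 := by
  refine Nat.lt_succ_of_le ((norm_left_unwind_mk_le _ _).trans ?_)
  simp [List.length_filter_le]

theorem derivedSeries_semidirect_le {N G : Type*} [Group N] [CommGroup G] (φ : G →* MulAut N)
    (n : ℕ) : derivedSeries (N ⋊[φ] G) (n + 1) ≤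
      (derivedSeries N n).map SemidirectProduct.inl := by
  induction n with
  | zero =>
    rw [zero_add, derivedSeries_one, derivedSeries_zero, ← MonoidHom.range_eq_map,
      SemidirectProduct.range_inl_eq_ker_rightHom]
    exact Abelianization.commutator_subset_ker _
  | succ n ih =>
    rw [derivedSeries_succ, derivedSeries_succ N, Subgroup.map_commutator]
    exact Subgroup.commutator_mono ih ih

/-- Nontrivial elements of the `n`-th derived subgroup of a free group have length
greater than `n`. -/
theorem lt_norm_of_mem_derivedSeries {α : Type*} [DecidableEq α] (n : ℕ) (w : FreeGroup α)
    (hw : w ∈ derivedSeries (FreeGroup α) n) (h1 : w ≠ 1) : n < w.norm := by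
  induction n generalizing α with
  | zero => exact Nat.pos_of_ne_zero fun h ↦ h1 (FreeGroup.norm_eq_zero.1 h)
  | succ n ih =>
    obtain ⟨L, hL⟩ : ∃ L, w.toWord = L := ⟨_, rfl⟩
    have hwL : w = FreeGroup.mk L := by rw [← hL, FreeGroup.mk_toWord]
    have hn : w.norm = L.length := by rw [FreeGroup.norm, hL]
    rcases L with _ | ⟨⟨x, b⟩, L⟩
    · exact absurd (hwL.trans FreeGroup.one_eq_mk.symm) h1
    have hmem := map_derivedSeries_le_derivedSeries (unwind x) (n + 1)
      (Subgroup.mem_map_of_mem _ hw)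
    obtain ⟨u, hu, hu'⟩ := derivedSeries_semidirect_le _ _ hmem
    have hlt := norm_left_unwind_lt x b L
    rw [← hwL, ← hu', SemidirectProduct.left_inl] at hlt
    have hu1 : u ≠ 1 := by
      rintro rfl
      rw [map_one] at hu'
      exact h1 (unwind_injective x (by rw [← hu', map_one]))
    have := ih u hu hu1
    rw [hn, List.length_cons]
    omega

/-- The homomorphism sending the `k`-th letter to `x₀ ^ k * x₁ * x₀ ^ (-k)`. -/
def conjPowHom : FreeGroup ℤ →* FreeGroup (Fin 2) :=
  FreeGroup.lift fun k ↦ FreeGroup.of 0 ^ k * FreeGroup.of 1 * FreeGroup.of 0 ^ (-k)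

theorem conjPowHom_injective : Function.Injective conjPowHom := by
  have h : (unwind (0 : Fin 2)).comp conjPowHom =
      SemidirectProduct.inl.comp (FreeGroup.map fun k : ℤ ↦ ((1 : Fin 2), k)) := by
    apply FreeGroup.ext_hom
    intro k
    have := SemidirectProduct.inl_aut (φ := indexShift (Fin 2)) (Multiplicative.ofAdd k)
      (FreeGroup.of (1, 0))
    rw [indexShift_of] at this
    simp only [MonoidHom.comp_apply, FreeGroup.map.of]
    simp only [toAdd_ofAdd, zero_add] at this
    rw [this]
    have hz : (SemidirectProduct.inr (Multiplicative.ofAdd k) :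
        FreeGroup (Fin 2 × ℤ) ⋊[indexShift (Fin 2)] Multiplicative ℤ) =
        unwind 0 (FreeGroup.of 0) ^ k := by
      rw [unwind, FreeGroup.lift_apply_of, if_pos rfl, ← map_zpow, ← ofAdd_zsmul]
      simp
    rw [map_inv, hz, ← map_zpow]
    simp [conjPowHom, unwind]
  have hinj : Function.Injective ((unwind (0 : Fin 2)).comp conjPowHom) := by
    rw [h]
    exact SemidirectProduct.inl_injective.comp
      (FreeGroup.map_injective fun a b hab ↦ (Prod.ext_iff.1 hab).2)
  exact Function.Injective.of_comp hinj

/-- An injective endomorphism of the free group of rank two with image in its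
commutator subgroup. -/
def commEndo : FreeGroup (Fin 2) →* FreeGroup (Fin 2) :=
  conjPowHom.comp (FreeGroup.lift fun i ↦
    FreeGroup.of (2 * (i : ℤ)) * (FreeGroup.of (2 * (i : ℤ) + 1))⁻¹)

theorem commEndo_injective : Function.Injective commEndo := by
  refine conjPowHom_injective.comp ?_
  have h : (FreeGroup.lift fun k : ℤ ↦ if k = 0 then FreeGroup.of (0 : Fin 2) else
      if k = 2 then FreeGroup.of 1 else 1).comp (FreeGroup.lift fun i : Fin 2 ↦
    FreeGroup.of (2 * (i : ℤ)) * (FreeGroup.of (2 * (i : ℤ) + 1))⁻¹) = MonoidHom.id _ := by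
    apply FreeGroup.ext_hom
    intro i
    fin_cases i <;> simp
  exact Function.LeftInverse.injective fun w ↦ DFunLike.congr_fun h w

theorem commEndo_of (i : Fin 2) : commEndo (FreeGroup.of i) =
    FreeGroup.of 0 ^ (2 * (i : ℕ)) *
      (FreeGroup.of 1 * FreeGroup.of 0 * (FreeGroup.of 1)⁻¹ * (FreeGroup.of 0)⁻¹) *
        (FreeGroup.of 0 ^ (2 * (i : ℕ)))⁻¹ := by
  fin_cases i <;> simp [commEndo, conjPowHom] <;> group

theorem norm_commEndo_of_le (i : Fin 2) : (commEndo (FreeGroup.of i)).norm ≤ 8 := by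
  fin_cases i <;> rw [commEndo_of] <;> decide

theorem commEndo_mem_commutator (w : FreeGroup (Fin 2)) :
    commEndo w ∈ derivedSeries (FreeGroup (Fin 2)) 1 := by
  rw [derivedSeries_one]
  induction w using FreeGroup.induction_on with
  | C1 => simp
  | of i =>
    rw [commEndo_of]
    exact Subgroup.Normal.conj_mem inferInstance _
      (Subgroup.commutator_mem_commutator (Subgroup.mem_top _) (Subgroup.mem_top _)) _
  | inv_of i h =>
    rw [map_inv]
    exact inv_mem h
  | mul u v hu hv =>
    rw [map_mul]
    exact mul_mem hu hv

theorem commEndo_mem_derivedSeries (n : ℕ) (w : FreeGroup (Fin 2))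
    (hw : w ∈ derivedSeries (FreeGroup (Fin 2)) n) :
    commEndo w ∈ derivedSeries (FreeGroup (Fin 2)) (n + 1) := by
  have h : (derivedSeries (FreeGroup (Fin 2)) n).map commEndo ≤
      derivedSeries (FreeGroup (Fin 2)) (n + 1) := by
    clear hw
    induction n with
    | zero =>
      rintro _ ⟨u, -, rfl⟩
      exact commEndo_mem_commutator u
    | succ n ih =>
      rw [derivedSeries_succ, derivedSeries_succ _ (n + 1), Subgroup.map_commutator]
      exact Subgroup.commutator_mono ih ih
  exact h (Subgroup.mem_map_of_mem _ hw)

/-- `g` is a product of at most `n` elements of `S ∪ S⁻¹`. -/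
def InBall {G : Type*} [Group G] (S : Set G) (n : ℕ) (g : G) : Prop :=
  ∃ L : List G, (∀ x ∈ L, x ∈ S ∨ x⁻¹ ∈ S) ∧ L.length ≤ n ∧ L.prod = g

namespace InBall

variable {G : Type*} [Group G] {S : Set G}

theorem one (n : ℕ) : InBall S n 1 := ⟨[], by simp, by simp, by simp⟩

theorem of_mem {g : G} (hg : g ∈ S) : InBall S 1 g := ⟨[g], by simp [hg], by simp, by simp⟩

theorem mono {m n : ℕ} {g : G} (h : InBall S m g) (hmn : m ≤ n) : InBall S n g := by
  obtain ⟨L, h1, h2, h3⟩ := h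
  exact ⟨L, h1, h2.trans hmn, h3⟩

theorem mul {m n : ℕ} {g h : G} (hg : InBall S m g) (hh : InBall S n h) :
    InBall S (m + n) (g * h) := by
  obtain ⟨L, h1, h2, rfl⟩ := hg
  obtain ⟨L', h1', h2', rfl⟩ := hh
  refine ⟨L ++ L', fun x hx ↦ ?_, by simp; omega, by simp⟩
  rcases List.mem_append.1 hx with hx | hx
  exacts [h1 x hx, h1' x hx]

theorem inv {n : ℕ} {g : G} (hg : InBall S n g) : InBall S n g⁻¹ := by
  obtain ⟨L, h1, h2, rfl⟩ := hg
  refine ⟨(L.map (·⁻¹)).reverse, fun x hx ↦ ?_, by simpa using h2, (List.prod_inv_reverse L).symm⟩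
  simp only [List.mem_reverse, List.mem_map] at hx
  obtain ⟨y, hy, rfl⟩ := hx
  simpa [or_comm] using h1 y hy

theorem pow {n : ℕ} {g : G} (hg : InBall S n g) (k : ℕ) : InBall S (k * n) (g ^ k) := by
  induction k with
  | zero => simpa using one _
  | succ k ih =>
    rw [pow_succ, Nat.succ_mul]
    exact ih.mul hg

theorem map {H : Type*} [Group H] {T : Set H} (φ : G →* H) (hφ : ∀ s ∈ S, φ s ∈ T) {n : ℕ}
    {g : G} (hg : InBall S n g) : InBall T n (φ g) := by
  obtain ⟨L, h1, h2, rfl⟩ := hg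
  refine ⟨L.map φ, fun x hx ↦ ?_, by simpa using h2, (List.prod_hom L φ)⟩
  obtain ⟨y, hy, rfl⟩ := List.mem_map.1 hx
  exact (h1 y hy).imp (hφ y) fun h ↦ by simpa using hφ _ h

theorem lift {ι : Type*} [DecidableEq ι] {n : ℕ} {g : ι → G} (hg : ∀ i, InBall S n (g i))
    (w : FreeGroup ι) : InBall S (w.norm * n) (FreeGroup.lift g w) := by
  have key : ∀ L : List (ι × Bool), InBall S (L.length * n) (FreeGroup.lift g (FreeGroup.mk L)) := by
    intro L
    induction L with
    | nil => exact one _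
    | cons p L ih =>
      obtain ⟨i, b⟩ := p
      rw [FreeGroup.mk_cons_eq, map_mul, List.length_cons, Nat.succ_mul, add_comm]
      refine mul ?_ ih
      cases b
      · simpa using (hg i).inv
      · simpa using hg i
  have h := key w.toWord
  rwa [FreeGroup.mk_toWord] at h

theorem wlen_le {n : ℕ} {g : G} (hg : InBall S n g) : wlen S g ≤ n := by
  obtain ⟨L, h1, h2, rfl⟩ := hg
  refine le_trans (Nat.sInf_le ?_) h2
  exact ⟨fun i ↦ L.get i, fun i ↦ h1 _ (L.get_mem i), by simp⟩

theorem of_wlen (hS : Subgroup.closure S = ⊤) (g : G) : InBall S (wlen S g) g := by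
  have hne : {n | ∃ f : Fin n → G, (∀ i, f i ∈ S ∨ (f i)⁻¹ ∈ S) ∧
      (List.ofFn f).prod = g}.Nonempty := by
    have hg : g ∈ Submonoid.closure (S ∪ S⁻¹) := by
      rw [← Subgroup.closure_toSubmonoid, hS]
      exact Subgroup.mem_top g
    obtain ⟨L, h1, h2⟩ := Submonoid.exists_list_of_mem_closure hg
    refine ⟨L.length, fun i ↦ L.get i, fun i ↦ h1 _ (L.get_mem i), ?_⟩
    simpa using h2
  obtain ⟨u, hu, hu'⟩ := Nat.sInf_mem hne
  refine ⟨List.ofFn u, fun x hx ↦ ?_, (List.length_ofFn).le, hu'⟩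
  obtain ⟨i, rfl⟩ := List.mem_ofFn.1 hx
  exact hu i

end InBall

theorem FreeGroup.inBall_norm {ι : Type*} [DecidableEq ι] (w : FreeGroup ι) :
    InBall (Set.range FreeGroup.of) w.norm w := by
  have := InBall.lift (S := Set.range FreeGroup.of) (n := 1) (g := FreeGroup.of (α := ι))
    (fun i ↦ InBall.of_mem (Set.mem_range_self i)) w
  simpa [FreeGroup.lift_of_apply] using this

theorem InBall.norm_le {ι : Type*} [DecidableEq ι] {n : ℕ} {w : FreeGroup ι}
    (h : InBall (Set.range FreeGroup.of) n w) : w.norm ≤ n := by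
  obtain ⟨L, h1, h2, rfl⟩ := h
  refine le_trans ?_ h2
  clear h2
  induction L with
  | nil => simp
  | cons x L ih =>
    have hx : x.norm = 1 := by
      rcases h1 x (by simp) with ⟨i, rfl⟩ | ⟨i, hi⟩
      · exact FreeGroup.norm_of i
      · rw [← FreeGroup.norm_inv_eq, ← hi, FreeGroup.norm_of]
    rw [List.prod_cons, List.length_cons]
    have := ih fun y hy ↦ h1 y (by simp [hy])
    have := FreeGroup.norm_mul_le x L.prod
    omega

theorem norm_commEndo_le (w : FreeGroup (Fin 2)) : (commEndo w).norm ≤ 8 * w.norm := by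
  have h := InBall.lift (S := Set.range (FreeGroup.of (α := Fin 2))) (n := 8)
    (g := fun i ↦ commEndo (FreeGroup.of i))
    (fun i ↦ (FreeGroup.inBall_norm _).mono (norm_commEndo_of_le i)) w
  rw [← FreeGroup.lift_unique commEndo fun _ ↦ rfl] at h
  rw [mul_comm]
  exact h.norm_le

/-- The least `d` such that all nontrivial elements of the `d`-th derived subgroup of the
free group of rank two have length greater than `l`. -/
noncomputable def derivedDepth (l : ℕ) : ℕ :=
  sInf {d | ∀ w ∈ derivedSeries (FreeGroup (Fin 2)) d, w ≠ 1 → l < w.norm}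

theorem derivedDepth_spec {l : ℕ} {w : FreeGroup (Fin 2)}
    (hw : w ∈ derivedSeries (FreeGroup (Fin 2)) (derivedDepth l)) (h1 : w ≠ 1) : l < w.norm :=
  Nat.sInf_mem (s := {d | ∀ w ∈ derivedSeries (FreeGroup (Fin 2)) d, w ≠ 1 → l < w.norm})
    ⟨l, fun w hw h1 ↦ lt_norm_of_mem_derivedSeries l w hw h1⟩ w hw h1

theorem derivedDepth_mono : Monotone derivedDepth := fun _ _ h ↦
  Nat.sInf_le fun _ hw h1 ↦ h.trans_lt (derivedDepth_spec hw h1)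

theorem derivedDepth_pos {l : ℕ} (hl : 1 ≤ l) : 1 ≤ derivedDepth l := by
  by_contra! h
  have := derivedDepth_spec (l := l) (w := FreeGroup.of 0)
    (by rw [Nat.lt_one_iff.1 h]; exact Subgroup.mem_top _) (FreeGroup.of_ne_one _)
  rw [FreeGroup.norm_of] at this
  omega

theorem exists_mem_derivedSeries_derivedDepth {l : ℕ} (hl : 1 ≤ l) :
    ∃ w ∈ derivedSeries (FreeGroup (Fin 2)) (derivedDepth l), w ≠ 1 ∧ w.norm ≤ 8 * l := by
  obtain ⟨d, hd⟩ := Nat.exists_eq_add_of_le' (derivedDepth_pos hl)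
  have hnot : d ∉ {d | ∀ w ∈ derivedSeries (FreeGroup (Fin 2)) d, w ≠ 1 → l < w.norm} :=
    Nat.notMem_of_lt_sInf (by change d < derivedDepth l; omega)
  simp only [Set.mem_ofPred_eq, not_forall, not_lt] at hnot
  obtain ⟨w, hw, h1, hle⟩ := hnot
  refine ⟨commEndo w, ?_, ?_, (norm_commEndo_le w).trans (by omega)⟩
  · rw [hd]
    exact commEndo_mem_derivedSeries d w hw
  · rwa [Ne, map_eq_one_iff _ commEndo_injective]

theorem map_freeGroup_lift {ι G H : Type*} [Group G] [Group H] (φ : G →* H) (g : ι → G)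
    (w : FreeGroup ι) : φ (FreeGroup.lift g w) = FreeGroup.lift (fun i ↦ φ (g i)) w :=
  FreeGroup.lift_unique (φ.comp (FreeGroup.lift g)) (fun _ ↦ by simp)

theorem lift_eq_one_of_forall_mem_zpowers {ι G : Type*} [Group G] {z : G} {g : ι → G}
    (hg : ∀ i, g i ∈ Subgroup.zpowers z) {w : FreeGroup ι}
    (hw : w ∈ derivedSeries (FreeGroup ι) 1) : FreeGroup.lift g w = 1 := by
  choose k hk using fun i ↦ Subgroup.mem_zpowers_iff.1 (hg i)
  have h := map_freeGroup_lift (zpowersHom G z) (fun i ↦ Multiplicative.ofAdd (k i)) w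
  simp only [zpowersHom_apply, toAdd_ofAdd, hk] at h
  rw [← h, show FreeGroup.lift (fun i ↦ Multiplicative.ofAdd (k i)) w = 1 from ?_]
  · simp
  · rw [derivedSeries_one] at hw
    exact Abelianization.commutator_subset_ker _ hw

theorem lift_eq_one_of_derivedSeries_eq_bot {ι G : Type*} [Group G] {n : ℕ}
    (hG : derivedSeries G n = ⊥) (g : ι → G) {w : FreeGroup ι}
    (hw : w ∈ derivedSeries (FreeGroup ι) n) : FreeGroup.lift g w = 1 := by
  rw [← Subgroup.mem_bot, ← hG]
  exact map_derivedSeries_le_derivedSeries _ n (Subgroup.mem_map_of_mem _ hw)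

/-- The free soluble group of rank two and derived length `d`. -/
abbrev FreeSoluble (d : ℕ) : Type := FreeGroup (Fin 2) ⧸ derivedSeries (FreeGroup (Fin 2)) d

theorem derivedSeries_freeSoluble (d : ℕ) : derivedSeries (FreeSoluble d) d = ⊥ := by
  rw [← map_derivedSeries_eq (QuotientGroup.mk'_surjective _), QuotientGroup.map_mk'_self]

/-- The `i`-th standard generator of the free soluble group. -/
def FreeSoluble.gen (d : ℕ) (i : Fin 2) : FreeSoluble d := QuotientGroup.mk (FreeGroup.of i)

theorem FreeSoluble.lift_gen (d : ℕ) (w : FreeGroup (Fin 2)) :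
    FreeGroup.lift (FreeSoluble.gen d) w = QuotientGroup.mk w :=
  (FreeGroup.lift_unique (QuotientGroup.mk' _) fun _ ↦ rfl).symm

section Ambient

variable (d : ℕ → ℕ)

/-- The product over all `r` of the functions from `ℤ` to the free soluble group of derived
length `d r`. -/
abbrev Base : Type := ∀ r : ℕ, ℤ → FreeSoluble (d r)

/-- The translation action of `ℤ` on `Base d`. -/
def baseShift : Multiplicative ℤ →* MulAut (Base d) where
  toFun m :=
    { toFun := fun u r s ↦ u r (s - m.toAdd)
      invFun := fun u r s ↦ u r (s + m.toAdd)
      left_inv := fun u ↦ by ext; simp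
      right_inv := fun u ↦ by ext; simp
      map_mul' := fun u v ↦ rfl }
  map_one' := by
    ext u r s
    simp
  map_mul' m n := by
    ext u r s
    simp [sub_sub]

theorem baseShift_apply (m : Multiplicative ℤ) (u : Base d) (r : ℕ) (s : ℤ) :
    baseShift d m u r s = u r (s - m.toAdd) := rfl

/-- The semidirect product of `Base d` with `ℤ`. -/
abbrev Ambient : Type := Base d ⋊[baseShift d] Multiplicative ℤ

/-- The element whose `r`-th function is supported at `0`, with value the first generator. -/
def baseFst : Base d := fun r s ↦ if s = 0 then FreeSoluble.gen (d r) 0 else 1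

/-- The element whose `r`-th function is supported at `r`, with value the second generator. -/
def baseSnd : Base d := fun r s ↦ if s = r then FreeSoluble.gen (d r) 1 else 1

/-- The generating set of the lawless group. -/
def ambientGens : Set (Ambient d) :=
  {SemidirectProduct.inr (Multiplicative.ofAdd 1), SemidirectProduct.inl (baseFst d),
    SemidirectProduct.inl (baseSnd d)}

/-- The generators that an element of the ball of radius `n` can see in its `r`-th function
at position `s`. -/
def visible (n r : ℕ) (s : ℤ) : Subgroup (FreeSoluble (d r)) :=
  Subgroup.closure {z | (z = FreeSoluble.gen (d r) 0 ∧ |s| ≤ n) ∨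
    (z = FreeSoluble.gen (d r) 1 ∧ |s - r| ≤ n)}

theorem visible_le (n r : ℕ) (s s' : ℤ) (h : |s - s'| ≤ 1) :
    visible d n r s' ≤ visible d (n + 1) r s := by
  refine Subgroup.closure_mono ?_
  rintro z (⟨hz, hs⟩ | ⟨hz, hs⟩)
  · refine Or.inl ⟨hz, ?_⟩
    rw [abs_le] at *
    push_cast
    omega
  · refine Or.inr ⟨hz, ?_⟩
    rw [abs_le] at *
    push_cast
    omega

theorem baseFst_mem_visible (n r : ℕ) (s : ℤ) : baseFst d r s ∈ visible d n r s := by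
  unfold baseFst
  split_ifs with h
  · exact Subgroup.subset_closure (Or.inl ⟨rfl, by simp [h]⟩)
  · exact one_mem _

theorem baseSnd_mem_visible (n r : ℕ) (s : ℤ) : baseSnd d r s ∈ visible d n r s := by
  unfold baseSnd
  split_ifs with h
  · exact Subgroup.subset_closure (Or.inr ⟨rfl, by simp [h]⟩)
  · exact one_mem _

theorem visible_le_zpowers {n r : ℕ} (h : 2 * n < r) (s : ℤ) :
    ∃ z, visible d n r s ≤ Subgroup.zpowers z := by
  by_cases hs : |s| ≤ n
  · refine ⟨FreeSoluble.gen (d r) 0, (Subgroup.closure_le _).2 ?_⟩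
    rintro z (⟨rfl, -⟩ | ⟨-, hs'⟩)
    · exact Subgroup.mem_zpowers _
    · rw [abs_le] at *
      omega
  · refine ⟨FreeSoluble.gen (d r) 1, (Subgroup.closure_le _).2 ?_⟩
    rintro z (⟨-, hs'⟩ | ⟨rfl, -⟩)
    · exact absurd hs' hs
    · exact Subgroup.mem_zpowers _

theorem left_mem_visible {n : ℕ} {g : Ambient d} (hg : InBall (ambientGens d) n g) (r : ℕ)
    (s : ℤ) : g.left r s ∈ visible d n r s := by
  obtain ⟨L, h1, h2, rfl⟩ := hg
  induction L generalizing n s with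
  | nil => exact one_mem _
  | cons x L ih =>
    obtain ⟨n, rfl⟩ : ∃ m, n = m + 1 := Nat.exists_eq_add_of_le' (by simp at h2; omega)
    have hL := fun s ↦ ih (n := n) s (fun y hy ↦ h1 y (by simp [hy])) (by simpa using h2)
    rw [List.prod_cons, SemidirectProduct.mul_left, Pi.mul_apply, Pi.mul_apply, baseShift_apply]
    have hx : x.left r s ∈ visible d (n + 1) r s ∧ |x.right.toAdd| ≤ 1 := by
      rcases h1 x (by simp) with hx | hx
      · rcases hx with rfl | rfl | rfl
        · exact ⟨one_mem _, by simp⟩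
        · exact ⟨baseFst_mem_visible d _ r s, by simp⟩
        · exact ⟨baseSnd_mem_visible d _ r s, by simp⟩
      · rcases hx with hx | hx | hx
        · rw [← inv_inv x, hx]
          exact ⟨one_mem _, by simp⟩
        · rw [← inv_inv x, hx, ← map_inv]
          exact ⟨inv_mem (baseFst_mem_visible d _ r s), by simp⟩
        · rw [← inv_inv x, hx, ← map_inv]
          exact ⟨inv_mem (baseSnd_mem_visible d _ r s), by simp⟩
    exact mul_mem hx.1 (visible_le d n r s _ (by simpa using hx.2) (hL _))

theorem lift_commEndo_eq_one {n : ℕ} {g : Fin 2 → Ambient d}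
    (hg : ∀ i, InBall (ambientGens d) n (g i)) {e : ℕ} (he : 1 ≤ e)
    (hd : ∀ r ≤ 16 * n, d r ≤ e) {v : FreeGroup (Fin 2)}
    (hv : v ∈ derivedSeries (FreeGroup (Fin 2)) e) : FreeGroup.lift g (commEndo v) = 1 := by
  set U : Fin 2 → Ambient d := fun i ↦ FreeGroup.lift g (commEndo (FreeGroup.of i))
  have hright : ∀ i, (U i).right = 1 := fun i ↦ by
    have h := Abelianization.commutator_subset_ker
      (SemidirectProduct.rightHom.comp (FreeGroup.lift g))
      (derivedSeries_one (FreeGroup (Fin 2)) ▸ commEndo_mem_commutator (FreeGroup.of i))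
    exact h
  have hball : ∀ i, InBall (ambientGens d) (8 * n) (U i) := fun i ↦
    (InBall.lift hg _).mono (Nat.mul_le_mul_right n (norm_commEndo_of_le i))
  have hinl : U = fun i ↦ SemidirectProduct.inl (U i).left := by
    funext i
    ext1
    · rfl
    · exact hright i
  have hlift : FreeGroup.lift g (commEndo v) = FreeGroup.lift U v :=
    FreeGroup.lift_unique ((FreeGroup.lift g).comp commEndo) fun _ ↦ rfl
  rw [hlift, hinl, ← map_freeGroup_lift, map_eq_one_iff _ SemidirectProduct.inl_injective]
  funext r s
  have heval := map_freeGroup_lift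
    ((Pi.evalMonoidHom (fun _ : ℤ ↦ FreeSoluble (d r)) s).comp
      (Pi.evalMonoidHom (fun r : ℕ ↦ ℤ → FreeSoluble (d r)) r)) (fun i ↦ (U i).left) v
  refine heval.trans ?_
  by_cases hr : r ≤ 16 * n
  · exact lift_eq_one_of_derivedSeries_eq_bot (derivedSeries_freeSoluble (d r)) _
      (derivedSeries_antitone _ (hd r hr) hv)
  · obtain ⟨z, hz⟩ := visible_le_zpowers d (n := 8 * n) (r := r) (by omega) s
    exact lift_eq_one_of_forall_mem_zpowers (z := z)
      (fun i ↦ hz (left_mem_visible d (hball i) r s)) (derivedSeries_antitone _ he hv)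

theorem lift_conj_ne_one {r : ℕ} {w : FreeGroup (Fin 2)}
    (hw : w ∉ derivedSeries (FreeGroup (Fin 2)) (d r)) :
    FreeGroup.lift ![(SemidirectProduct.inl (baseFst d) : Ambient d),
      (SemidirectProduct.inr (Multiplicative.ofAdd 1) ^ r)⁻¹ *
        SemidirectProduct.inl (baseSnd d) *
          SemidirectProduct.inr (Multiplicative.ofAdd 1) ^ r] w ≠ 1 := by
  intro h
  set t : Multiplicative ℤ := Multiplicative.ofAdd 1 ^ r
  have hfun : ![(SemidirectProduct.inl (baseFst d) : Ambient d),
      (SemidirectProduct.inr (Multiplicative.ofAdd 1) ^ r)⁻¹ *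
        SemidirectProduct.inl (baseSnd d) *
          SemidirectProduct.inr (Multiplicative.ofAdd 1) ^ r] =
      fun i ↦ SemidirectProduct.inl (![baseFst d, baseShift d t⁻¹ (baseSnd d)] i) := by
    funext i
    fin_cases i
    · rfl
    · refine Eq.trans ?_ (SemidirectProduct.inl_aut t⁻¹ (baseSnd d)).symm
      simp only [t, map_inv, map_pow, inv_inv]
      rfl
  rw [hfun, ← map_freeGroup_lift, map_eq_one_iff _ SemidirectProduct.inl_injective] at h
  have heval := map_freeGroup_lift
    ((Pi.evalMonoidHom (fun _ : ℤ ↦ FreeSoluble (d r)) 0).comp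
      (Pi.evalMonoidHom (fun r : ℕ ↦ ℤ → FreeSoluble (d r)) r))
      ![baseFst d, baseShift d t⁻¹ (baseSnd d)] w
  rw [h, map_one] at heval
  apply hw
  rw [← QuotientGroup.eq_one_iff, ← FreeSoluble.lift_gen, heval]
  congr 2
  funext i
  fin_cases i
  · simp [baseFst]
  · change FreeSoluble.gen (d r) 1 = baseShift d t⁻¹ (baseSnd d) r 0
    rw [baseShift_apply]
    simp [baseSnd, t]

/-- The subgroup of `Ambient d` generated by `ambientGens d`. -/
abbrev LawlessGroup : Type := Subgroup.closure (ambientGens d)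

/-- The generating set of `LawlessGroup d`. -/
def lawlessGens : Set (LawlessGroup d) := Subtype.val ⁻¹' ambientGens d

theorem lawlessGens_finite : (lawlessGens d).Finite :=
  Set.Finite.preimage Subtype.val_injective.injOn (by simp [ambientGens])

theorem closure_lawlessGens : Subgroup.closure (lawlessGens d) = ⊤ :=
  Subgroup.closure_closure_coe_preimage

theorem exists_lift_ne_one {r : ℕ} {w : FreeGroup (Fin 2)}
    (hw : w ∉ derivedSeries (FreeGroup (Fin 2)) (d r)) :
    ∃ g : Fin 2 → LawlessGroup d, FreeGroup.lift g w ≠ 1 ∧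
      ∑ i, wlen (lawlessGens d) (g i) ≤ 2 * r + 2 := by
  have hsub : ∀ x ∈ ambientGens d, x ∈ Subgroup.closure (ambientGens d) := fun _ h ↦
    Subgroup.subset_closure h
  let t : LawlessGroup d := ⟨SemidirectProduct.inr (Multiplicative.ofAdd 1),
    hsub _ (Or.inl rfl)⟩
  let a : LawlessGroup d := ⟨SemidirectProduct.inl (baseFst d), hsub _ (Or.inr (Or.inl rfl))⟩
  let b : LawlessGroup d := ⟨SemidirectProduct.inl (baseSnd d), hsub _ (Or.inr (Or.inr rfl))⟩
  have ht : InBall (lawlessGens d) 1 t := InBall.of_mem (Or.inl rfl)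
  have ha : InBall (lawlessGens d) 1 a := InBall.of_mem (Or.inr (Or.inl rfl))
  have hb : InBall (lawlessGens d) 1 b := InBall.of_mem (Or.inr (Or.inr rfl))
  refine ⟨![a, (t ^ r)⁻¹ * b * t ^ r], fun h ↦ lift_conj_ne_one d hw ?_, ?_⟩
  · have h' := map_freeGroup_lift (Subgroup.subtype _) ![a, (t ^ r)⁻¹ * b * t ^ r] w
    rw [h, map_one] at h'
    rw [h']
    congr 2
    funext i
    fin_cases i <;> rfl
  · have h1 := ha.wlen_le
    have h2 := (((ht.pow r).inv.mul hb).mul (ht.pow r)).wlen_le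
    simp only [Fin.sum_univ_two, Matrix.cons_val_zero, Matrix.cons_val_one,
      Matrix.cons_val_fin_one]
    omega

theorem chi_le {r : ℕ} {w : FreeGroup (Fin 2)}
    (hw : w ∉ derivedSeries (FreeGroup (Fin 2)) (d r)) :
    chi (lawlessGens d) w ≤ 2 * r + 2 := by
  obtain ⟨g, hg, hle⟩ := exists_lift_ne_one d hw
  refine le_trans (Nat.sInf_le ?_) hle
  exact ⟨g, hg, rfl⟩

theorem lt_chi_commEndo {n e : ℕ} (he : 1 ≤ e) (hd : ∀ r ≤ 16 * n, d r ≤ e)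
    {v : FreeGroup (Fin 2)}
    (hv : v ∈ derivedSeries (FreeGroup (Fin 2)) e)
    (hlaw : ¬ IsLaw (LawlessGroup d) (commEndo v)) : n < chi (lawlessGens d) (commEndo v) := by
  simp only [IsLaw, not_forall] at hlaw
  obtain ⟨g₀, hg₀⟩ := hlaw
  obtain ⟨g, hg, hchi⟩ := Nat.sInf_mem (s := {c | ∃ g : Fin 2 → LawlessGroup d,
    FreeGroup.lift g (commEndo v) ≠ 1 ∧ c = ∑ i, wlen (lawlessGens d) (g i)}) ⟨_, g₀, hg₀, rfl⟩
  change chi (lawlessGens d) (commEndo v) = _ at hchi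
  by_contra! hle
  rw [hchi] at hle
  apply hg
  apply Subtype.val_injective
  refine (map_freeGroup_lift (Subgroup.subtype _) g _).trans
    (lift_commEndo_eq_one d (n := n) (fun i ↦ ?_) he hd hv)
  have hi : wlen (lawlessGens d) (g i) ≤ n :=
    (Finset.single_le_sum (fun j _ ↦ Nat.zero_le (wlen (lawlessGens d) (g j)))
      (Finset.mem_univ i)).trans hle
  exact ((InBall.of_wlen (closure_lawlessGens d) (g i)).mono hi).map _ fun s hs ↦ hs

theorem exists_embedding_freeGroup_fin (k : ℕ) :
    ∃ φ : FreeGroup (Fin k) →* FreeGroup (Fin 2), Function.Injective φ :=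
  ⟨conjPowHom.comp (FreeGroup.map fun i : Fin k ↦ (i : ℤ)), conjPowHom_injective.comp
    (FreeGroup.map_injective fun i j h ↦ Fin.ext (by exact_mod_cast h))⟩

theorem isLawless_lawlessGroup
    (hd : ∀ w : FreeGroup (Fin 2), w ≠ 1 → ∃ r, w ∉ derivedSeries (FreeGroup (Fin 2)) (d r)) :
    IsLawless (LawlessGroup d) := by
  intro k w hw hlaw
  obtain ⟨φ, hφ⟩ := exists_embedding_freeGroup_fin k
  obtain ⟨r, hr⟩ := hd (φ w) (by rwa [Ne, map_eq_one_iff _ hφ])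
  obtain ⟨g, hg, -⟩ := exists_lift_ne_one d hr
  refine hg ?_
  rw [← hlaw fun i ↦ FreeGroup.lift g (φ (FreeGroup.of i))]
  exact FreeGroup.lift_unique ((FreeGroup.lift g).comp φ) fun _ ↦ rfl

end Ambient

/-- The largest argument at which `f` takes a value at most `r`. -/
noncomputable def maxArg (f : ℕ → ℕ) (r : ℕ) : ℕ := sSup {l | 1 ≤ l ∧ f l ≤ r}

theorem maxArg_le {f : ℕ → ℕ} (hmono : ∀ ⦃m n : ℕ⦄, 1 ≤ m → m ≤ n → f m ≤ f n) {l r : ℕ}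
    (hl : 1 ≤ l) (h : r < f l) : maxArg f r ≤ l := by
  refine csSup_le' ?_
  rintro m ⟨-, hm⟩
  by_contra! hlm
  have := hmono hl hlm.le
  omega

theorem le_maxArg {f : ℕ → ℕ} (hmono : ∀ ⦃m n : ℕ⦄, 1 ≤ m → m ≤ n → f m ≤ f n)
    (hunb : ∀ N : ℕ, ∃ n : ℕ, 1 ≤ n ∧ N ≤ f n) {l : ℕ} (hl : 1 ≤ l) : l ≤ maxArg f (f l) := by
  refine le_csSup ?_ ⟨hl, le_rfl⟩
  obtain ⟨n, hn, hfn⟩ := hunb (f l + 1)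
  refine ⟨n, ?_⟩
  rintro m ⟨-, hm⟩
  by_contra! hnm
  have := hmono hn hnm.le
  omega

theorem pos_of_scaling {f : ℕ → ℕ} (hmono : ∀ ⦃m n : ℕ⦄, 1 ≤ m → m ≤ n → f m ≤ f n)
    (hunb : ∀ N : ℕ, ∃ n : ℕ, 1 ≤ n ∧ N ≤ f n)
    (hM : ∃ M : ℕ, 2 ≤ M ∧ ∀ n : ℕ, 1 ≤ n → f (M * n) ≤ M * f n) {l : ℕ} (hl : 1 ≤ l) :
    1 ≤ f l := by
  obtain ⟨M, hM2, hM⟩ := hM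
  by_contra! h
  have hpow : ∀ k : ℕ, f (M ^ k * l) = 0 := by
    intro k
    induction k with
    | zero => simpa using h
    | succ k ih =>
      have := hM (M ^ k * l) (Nat.mul_pos (by positivity) hl)
      rw [ih, ← mul_assoc, ← pow_succ'] at this
      simpa using this
  obtain ⟨n, hn, hfn⟩ := hunb 1
  have hle : n ≤ M ^ n * l := (Nat.lt_pow_self (by omega)).le.trans (Nat.le_mul_of_pos_right _ hl)
  have := hmono hn hle
  rw [hpow] at this
  omega

/-- If `f` is surjective, unbounded, nondecreasing, and `f(Mn) ≤ M·f(n)`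
for some `M ≥ 2` and all `n`, then there is a lawless group `Γ` generated by a finite set
`S` with `𝒜_Γ^S ≈ f`. -/
theorem stmt4 (f : ℕ → ℕ)
    (hmono : ∀ ⦃m n : ℕ⦄, 1 ≤ m → m ≤ n → f m ≤ f n)
    (hunb : ∀ N : ℕ, ∃ n : ℕ, 1 ≤ n ∧ N ≤ f n)
    (hsurj : ∀ m : ℕ, 1 ≤ m → ∃ n : ℕ, 1 ≤ n ∧ f n = m)
    (hM : ∃ M : ℕ, 2 ≤ M ∧ ∀ n : ℕ, 1 ≤ n → f (M * n) ≤ M * f n) :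
    ∃ (Γ : Type) (_ : Group Γ) (S : Set Γ),
      S.Finite ∧ Subgroup.closure S = ⊤ ∧ IsLawless Γ ∧ EquivGrowth (lawGrowth S) f := by
  have hpos : ∀ l, 1 ≤ l → 1 ≤ f l := fun l hl ↦ pos_of_scaling hmono hunb hM hl
  set d : ℕ → ℕ := fun r ↦ derivedDepth (maxArg f r)
  have hnotMem : ∀ l, 1 ≤ l → ∀ w : FreeGroup (Fin 2), w ≠ 1 → w.norm ≤ l →
      w ∉ derivedSeries (FreeGroup (Fin 2)) (d (f l)) := fun l hl w hw hle hmem ↦ by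
    have h1 := derivedDepth_spec hmem hw
    have h2 := le_maxArg hmono hunb hl
    omega
  have hupper : ∀ l, 1 ≤ l → ∀ w : FreeGroup (Fin 2), w ≠ 1 → wordLen w ≤ l →
      chi (lawlessGens d) w ≤ 4 * f l := fun l hl w hw hle ↦ by
    have h1 := chi_le d (hnotMem l hl w hw hle)
    have h2 := hpos l hl
    omega
  have hlawless : IsLawless (LawlessGroup d) := isLawless_lawlessGroup d fun w hw ↦
    ⟨_, hnotMem (w.norm + 1) (by omega) w hw (by omega)⟩
  refine ⟨LawlessGroup d, inferInstance, lawlessGens d, lawlessGens_finite d,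
    closure_lawlessGens d, hlawless, ⟨4, by norm_num, fun l hl ↦ ?_⟩,
    ⟨64, by norm_num, fun l hl ↦ ?_⟩⟩
  · refine csSup_le' ?_
    rintro _ ⟨w, hw, hle, rfl⟩
    exact (hupper l hl w hw hle).trans (Nat.mul_le_mul_left 4 (hmono hl (by omega)))
  · obtain ⟨v, hv, hv1, hnorm⟩ := exists_mem_derivedSeries_derivedDepth hl
    have hne : commEndo v ≠ 1 := by rwa [Ne, map_eq_one_iff _ commEndo_injective]
    have hfl := hpos l hl
    have hlt : (f l - 1) / 16 < chi (lawlessGens d) (commEndo v) :=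
      lt_chi_commEndo d (derivedDepth_pos hl)
        (fun r hr ↦ derivedDepth_mono (maxArg_le hmono hl (by omega))) hv (hlawless 2 _ hne)
    have hle : chi (lawlessGens d) (commEndo v) ≤ lawGrowth (lawlessGens d) (64 * l) := by
      refine le_csSup ⟨4 * f (64 * l), ?_⟩ ⟨_, hne, ?_, rfl⟩
      · rintro _ ⟨w, hw, hwl, rfl⟩
        exact hupper _ (by omega) w hw hwl
      · exact (norm_commEndo_le v).trans (by omega)
    omega
end
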